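/- arXiv:1909.03177 — 4 statements merged into one kernel-verified Lean document; each statement's English description precedes it below -/
import Mathlib

section
/- Let T > 0, T₁ ∈ (0, T], β > 0 and p ≥ 1. Suppose y ∈ W^{1,1}(0,T) with y(0) = y₀, that α : [0,T] → ℝ satisfies α(t) ≥ 0 for all t ∈ [0,T] and α(t) ≥ β for all t ∈ [T₁, T], that g ∈ L¹(0,T₁) ∩ L^p(T₁,T), and that y′(t) + α(t) y(t) ≤ g(t) for a.e. t ∈ [0,T]. Then sup_{0≤t≤T} y(t) ≤ |y₀| + (1 + β⁻¹)(‖g‖_{L¹(0,T₁)} + ‖g‖_{L^p(T₁,T)}). -/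
open MeasureTheory Set

lemma aux_cmp (a b c : ℝ) (y y' h : ℝ → ℝ)
    (hyc : ContinuousOn y (Icc a b))
    (hy'int : IntegrableOn y' (Icc a b))
    (hftc : ∀ s ∈ Icc a b, ∀ t ∈ Icc a b, y t = y s + ∫ r in s..t, y' r)
    (hh : IntegrableOn h (Icc a b)) (hh0 : ∀ t, 0 ≤ h t)
    (hode : ∀ᵐ t ∂(volume.restrict (Icc a b)), c < y t → y' t ≤ h t) :
    ∀ t ∈ Icc a b, y t ≤ max (y a) c + ∫ s in a..b, h s := by
  intro t ht
  have hsub : Icc a t ⊆ Icc a b := Icc_subset_Icc_right ht.2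
  have hcl : IsCompact (Icc a t ∩ y ⁻¹' (Iic (max (y a) c))) :=
    isCompact_Icc.of_isClosed_subset
      ((hyc.mono hsub).preimage_isClosed_of_isClosed isClosed_Icc isClosed_Iic) inter_subset_left
  obtain ⟨s, ⟨hs, hys⟩, hmax⟩ := hcl.exists_isGreatest
    ⟨a, ⟨le_refl a, ht.1⟩, le_max_left (y a) c⟩
  have hys' : y s ≤ max (y a) c := hys
  have hst : Icc s t ⊆ Icc a b := Icc_subset_Icc hs.1 ht.2
  have hb : a ≤ b := ht.1.trans ht.2
  have hi : ∀ f : ℝ → ℝ, IntegrableOn f (Icc a b) → IntervalIntegrable f volume s t := by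
    intro f hf
    rw [intervalIntegrable_iff_integrableOn_Icc_of_le hs.2]
    exact hf.mono_set hst
  have h1 : ∫ r in s..t, y' r ≤ ∫ r in s..t, h r := by
    apply intervalIntegral.integral_mono_ae_restrict hs.2 (hi _ hy'int) (hi _ hh)
    have h2 : ∀ᵐ r ∂(volume.restrict (Icc s t)), r ≠ s :=
      ae_restrict_of_ae (Measure.ae_ne volume s)
    filter_upwards [ae_restrict_of_ae_restrict_of_subset hst hode, h2,
      ae_restrict_mem measurableSet_Icc] with r hr hne hmem
    apply hr
    by_contra hcon
    have h3 : r ≤ s := hmax ⟨⟨hs.1.trans hmem.1, hmem.2⟩,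
      (not_lt.mp hcon).trans (le_max_right _ _)⟩
    exact hne (le_antisymm h3 hmem.1)
  have h2 : ∫ r in s..t, h r ≤ ∫ r in a..b, h r := by
    apply intervalIntegral.integral_mono_interval hs.1 hs.2 ht.2
    · exact Filter.Eventually.of_forall hh0
    · rw [intervalIntegrable_iff_integrableOn_Icc_of_le hb]
      exact hh
  have h3 := hftc s (hsub hs) t ht
  linarith

/-- Gronwall-type inequality (Lemma 3.1): if `y ∈ W^{1,1}(0,T)` (absolutely continuous,
i.e. `y` is recovered from its integrable derivative `y'` by the FTC), `α ≥ 0` on `[0,T]`,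
`α ≥ β > 0` on `[T₁,T]`, `g ∈ L¹(0,T₁) ∩ L^p(T₁,T)` and
`y' + α y ≤ g` a.e. on `[0,T]`, then
`sup_{0 ≤ t ≤ T} y(t) ≤ |y₀| + (1 + β⁻¹)(‖g‖_{L¹(0,T₁)} + ‖g‖_{L^p(T₁,T)})`. -/
theorem stmt0 (T T₁ β p y₀ : ℝ) (y y' g α : ℝ → ℝ)
    (hT : 0 < T) (hT₁ : T₁ ∈ Set.Ioc 0 T) (hβ : 0 < β) (hp : 1 ≤ p)
    (hy0 : y 0 = y₀)
    (hyc : ContinuousOn y (Icc 0 T))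
    (hy'int : IntegrableOn y' (Icc 0 T))
    (hftc : ∀ t ∈ Icc 0 T, y t = y 0 + ∫ s in (0:ℝ)..t, y' s)
    (hα0 : ∀ t ∈ Icc 0 T, 0 ≤ α t)
    (hαβ : ∀ t ∈ Icc T₁ T, β ≤ α t)
    (hg1 : IntegrableOn g (Icc 0 T₁))
    (hgp : IntegrableOn (fun s => |g s| ^ p) (Icc T₁ T))
    (hode : ∀ᵐ t ∂(volume.restrict (Icc 0 T)), y' t + α t * y t ≤ g t) :
    ∀ t ∈ Icc 0 T,
      y t ≤ |y₀| + (1 + β⁻¹) *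
        ((∫ s in (0:ℝ)..T₁, |g s|) + (∫ s in T₁..T, |g s| ^ p) ^ (1 / p)) := by
  obtain ⟨h0, h1⟩ := hT₁
  have hsub1 : Icc 0 T₁ ⊆ Icc 0 T := Icc_subset_Icc_right h1
  have hsub2 : Icc T₁ T ⊆ Icc 0 T := Icc_subset_Icc_left h0.le
  have hftc2 : ∀ s ∈ Icc 0 T, ∀ t ∈ Icc 0 T, y t = y s + ∫ r in s..t, y' r := by
    intro s hs t ht
    have hi : ∀ t ∈ Icc 0 T, IntervalIntegrable y' volume 0 t := by
      intro t ht
      rw [intervalIntegrable_iff_integrableOn_Icc_of_le ht.1]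
      exact hy'int.mono_set (Icc_subset_Icc_right ht.2)
    rw [hftc t ht, hftc s hs, ← intervalIntegral.integral_interval_sub_left (hi t ht) (hi s hs)]
    ring
  have hA : ∀ t ∈ Icc 0 T₁, y t ≤ max (y 0) 0 + ∫ s in (0:ℝ)..T₁, |g s| := by
    apply aux_cmp 0 T₁ 0 y y' (fun s => |g s|) (hyc.mono hsub1) (hy'int.mono_set hsub1)
      (fun s hs t ht => hftc2 s (hsub1 hs) t (hsub1 ht)) hg1.abs (fun t => abs_nonneg _)
    filter_upwards [ae_restrict_of_ae_restrict_of_subset hsub1 hode,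
      ae_restrict_mem measurableSet_Icc] with r hr hmem hpos
    have := mul_nonneg (hα0 r (hsub1 hmem)) hpos.le
    linarith [le_abs_self (g r)]
  have hm : max (y 0) 0 ≤ |y₀| := by
    rw [hy0]; exact max_le (le_abs_self _) (abs_nonneg _)
  have hI1 : 0 ≤ ∫ s in (0:ℝ)..T₁, |g s| :=
    intervalIntegral.integral_nonneg h0.le (fun _ _ => abs_nonneg _)
  have hI2 : 0 ≤ ∫ s in T₁..T, |g s| ^ p :=
    intervalIntegral.integral_nonneg h1 (fun _ _ => Real.rpow_nonneg (abs_nonneg _) _)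
  have hbi : 0 < β⁻¹ := inv_pos.mpr hβ
  set A := ∫ s in (0:ℝ)..T₁, |g s| with hAdef
  set B := ∫ s in T₁..T, |g s| ^ p with hBdef
  have hG : 0 ≤ B ^ (1 / p) := Real.rpow_nonneg hI2 _
  have hp0 : 0 < p := by linarith
  have hB : ∀ K : ℝ, B ^ (1 / p) < K → ∀ t ∈ Icc T₁ T,
      y t ≤ |y₀| + A + (1 + β⁻¹) * K := by
    intro K hK t ht
    have hK0 : 0 < K := hG.trans_lt hK
    have hBK : B ≤ K ^ p := by
      have := Real.rpow_le_rpow hG hK.le hp0.le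
      rwa [← Real.rpow_mul hI2, one_div, inv_mul_cancel₀ hp0.ne', Real.rpow_one] at this
    have hKp : 0 < K ^ p := Real.rpow_pos_of_pos hK0 p
    have h2 := aux_cmp T₁ T (K * β⁻¹) y y' (fun s => (K / K ^ p) * |g s| ^ p)
      (hyc.mono hsub2) (hy'int.mono_set hsub2)
      (fun s hs t ht => hftc2 s (hsub2 hs) t (hsub2 ht)) (hgp.const_mul _)
      (fun t => by positivity) (by
        filter_upwards [ae_restrict_of_ae_restrict_of_subset hsub2 hode,
          ae_restrict_mem measurableSet_Icc] with r hr hmem hpos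
        have hy : 0 < y r := lt_trans (by positivity) hpos
        have e1 : β * y r ≤ α r * y r := mul_le_mul_of_nonneg_right (hαβ r hmem) hy.le
        have e2 : K ≤ β * y r := by
          have := mul_le_mul_of_nonneg_left hpos.le hβ.le
          calc K = β * (K * β⁻¹) := by field_simp
            _ ≤ _ := this
        have e3 : |g r| ≤ K + K / K ^ p * |g r| ^ p := by
          have e4 : K / K ^ p * |g r| ^ p = K * (|g r| / K) ^ p := by
            rw [Real.div_rpow (abs_nonneg _) hK0.le]; ring
          rw [e4]
          have e6 : 0 ≤ (|g r| / K) ^ p := by positivity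
          have e5 : |g r| / K ≤ 1 + (|g r| / K) ^ p := by
            rcases le_total (|g r| / K) 1 with h | h
            · linarith
            · linarith [Real.self_le_rpow_of_one_le h hp]
          rw [div_le_iff₀ hK0] at e5
          linarith
        linarith [le_abs_self (g r)]) t ht
    rw [intervalIntegral.integral_const_mul, ← hBdef] at h2
    have h3 : K / K ^ p * B ≤ K := by
      calc K / K ^ p * B ≤ K / K ^ p * K ^ p := by gcongr
        _ = K := by field_simp
    have h4 := hA T₁ ⟨h0.le, le_refl _⟩
    have h5 : max (y T₁) (K * β⁻¹) ≤ |y₀| + A + K * β⁻¹ := by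
      have : 0 < K * β⁻¹ := by positivity
      apply max_le <;> linarith [abs_nonneg y₀]
    linarith
  intro t ht
  have hbA : 0 ≤ β⁻¹ * A := by positivity
  have hbG : 0 ≤ β⁻¹ * B ^ (1 / p) := by positivity
  rcases le_total t T₁ with h | h
  · have := hA t ⟨ht.1, h⟩
    linarith
  · apply le_of_forall_pos_le_add
    intro ε hε
    have h6 := hB (B ^ (1 / p) + ε / (1 + β⁻¹)) (by
      have : 0 < ε / (1 + β⁻¹) := by positivity
      linarith) t ⟨h, ht.2⟩
    have h7 : (1 + β⁻¹) * (B ^ (1 / p) + ε / (1 + β⁻¹)) = (1 + β⁻¹) * B ^ (1 / p) + ε := by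
      have : (1 + β⁻¹) ≠ 0 := by positivity
      rw [mul_add, mul_div_cancel₀ _ this]
    rw [h7] at h6
    linarith
end

section
/- Let D, χ > 0, u₋ > u₊ > 0, and v₊, v₋ ∈ ℝ satisfy the Rankine–Hugoniot conditions −s(u₊ − u₋) − χ(u₊ v₊ − u₋ v₋) = 0 and −s(v₊ − v₋) − (u₊ − u₋) = 0, where s = (−χ v₊ + ((χ v₊)² + 4χ u₋)^{1/2})/2 > 0. Then there exists a pair of smooth functions (U, V) : ℝ → ℝ satisfying −sU′ − χ(UV)′ = DU″ and −sV′ − U′ = 0 on ℝ, with U(z) → u₋, V(z) → v₋ as z → −∞ and U(z) → u₊, V(z) → v₊ as z → +∞, such that U′(z) < 0 and V′(z) > 0 for all z, |U′(z)| ≤ λ(u₋ − u₊) and |V′(z)| ≤ λ(u₋ − u₊)/s for all z, where λ = χ(u₋ − u₊)/(Ds) > 0; moreover this solution is unique up to translation: any two such monotone solutions (U₁,V₁) and (U₂,V₂) satisfy U₂(·) = U₁(· + c) and V₂(·) = V₁(· + c) for some c ∈ ℝ. -/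
open Filter

/-- `IsMonoWave D χ s up um vp vm lam U V` records that `(U, V)` is a smooth monotone
traveling wave profile of speed `s` for the system `u_t - χ(uv)_x = D u_xx, v_t - u_x = 0`,
connecting `(um, vm)` at `-∞` to `(up, vp)` at `+∞`, with `U' < 0 < V'` and the derivative
bounds `|U'| ≤ lam (um - up)`, `|V'| ≤ lam (um - up)/s`.
Here `up, um, vp, vm` stand for `u₊, u₋, v₊, v₋`. -/
def IsMonoWave (D χ s up um vp vm lam : ℝ) (U V : ℝ → ℝ) : Prop :=
  ContDiff ℝ (⊤ : ℕ∞) U ∧ ContDiff ℝ (⊤ : ℕ∞) V ∧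
  (∀ z, -s * deriv U z - χ * deriv (fun y => U y * V y) z = D * deriv (deriv U) z) ∧
  (∀ z, -s * deriv V z - deriv U z = 0) ∧
  Tendsto U atBot (nhds um) ∧ Tendsto U atTop (nhds up) ∧
  Tendsto V atBot (nhds vm) ∧ Tendsto V atTop (nhds vp) ∧
  (∀ z, deriv U z < 0) ∧ (∀ z, 0 < deriv V z) ∧
  (∀ z, |deriv U z| ≤ lam * (um - up)) ∧ (∀ z, |deriv V z| ≤ lam * (um - up) / s)

theorem aux_unique (D χ up um vp vm s l : ℝ)
    (hD : 0 < D) (hχ : 0 < χ) (huu : up < um) (hspos : 0 < s)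
    (hS : s * s + χ * vp * s = χ * um) (U V : ℝ → ℝ)
    (h : IsMonoWave D χ s up um vp vm l U V) :
    ∃ c : ℝ, ∀ z, U z = up + (um - up) / (1 + Real.exp (χ * (um - up) / (D * s) * (z + c))) ∧
      V z = vp + (up - U z) / s := by
  obtain ⟨cU, cV, h1, h2, tUb, tUt, tVb, tVt, hU, hV, -, -⟩ := h
  have dU : Differentiable ℝ U := cU.differentiable (by simp)
  have dV : Differentiable ℝ V := cV.differentiable (by simp)
  have cU' : ContDiff ℝ 1 (deriv U) := by
    have : ContDiff ℝ 2 U := cU.of_le (WithTop.coe_le_coe.2 (le_top : (2 : ℕ∞) ≤ ⊤))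
    exact (contDiff_succ_iff_deriv.1 (by simpa [one_add_one_eq_two] using this)).2.2
  have ddU : Differentiable ℝ (deriv U) := cU'.differentiable (by simp)
  have hanti : StrictAnti U := strictAnti_of_deriv_neg hU
  have hlo : ∀ z, up < U z := fun z =>
    lt_of_le_of_lt (hanti.antitone.le_of_tendsto tUt (z+1)) (hanti (by linarith))
  have hhi : ∀ z, U z < um := fun z =>
    lt_of_lt_of_le (hanti (by linarith : z - 1 < z)) (hanti.antitone.ge_of_tendsto tUb (z-1))
  have hVeq : ∀ z, V z = vp + (up - U z) / s := by
    have hd : ∀ z, HasDerivAt (fun z => s * V z + U z) 0 z := fun z => by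
      have := ((dV z).hasDerivAt.const_mul s).add (dU z).hasDerivAt
      refine HasDerivAt.congr_deriv this ?_
      linarith [h2 z]
    have hc : ∀ z, s * V z + U z = s * vp + up := by
      intro z
      have ht : Tendsto (fun z => s * V z + U z) atTop (nhds (s * vp + up)) :=
        (tVt.const_mul s).add tUt
      have hcst : ∀ y, s * V y + U y = s * V z + U z := fun y =>
        is_const_of_deriv_eq_zero (fun x => (hd x).differentiableAt) (fun x => (hd x).deriv) y z
      simp only [hcst] at ht
      exact tendsto_nhds_unique tendsto_const_nhds ht
    intro z
    have := hc z
    field_simp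
    linarith
  set F : ℝ → ℝ := fun z => D * deriv U z + s * U z + χ * (U z * V z) with hF
  have hFd : ∀ z, HasDerivAt F 0 z := fun z => by
    have hm : HasDerivAt (fun y => U y * V y) (deriv (fun y => U y * V y) z) z :=
      ((dU z).mul (dV z)).hasDerivAt
    have := (((ddU z).hasDerivAt.const_mul D).add ((dU z).hasDerivAt.const_mul s)).add
      (hm.const_mul χ)
    refine HasDerivAt.congr_deriv this ?_
    linarith [h1 z]
  obtain ⟨K, hK⟩ : ∃ K, ∀ z, D * deriv U z = K - χ / s * ((U z - up) * (um - U z)) := by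
    refine ⟨F 0 - s * up - χ * up * vp, fun z => ?_⟩
    have hc : F z = F 0 :=
      is_const_of_deriv_eq_zero (fun x => (hFd x).differentiableAt) (fun x => (hFd x).deriv) z 0
    rw [← hc]
    simp only [hF, hVeq z]
    have : um = (s * s + χ * vp * s) / χ := by field_simp; linarith
    rw [this]
    field_simp
    ring
  have hq : ∀ z, 0 < χ / s * ((U z - up) * (um - U z)) := fun z => by
    have a := sub_pos.2 (hlo z)
    have b := sub_pos.2 (hhi z)
    positivity
  have hK1 : K ≤ 0 := by
    have ht : Tendsto (fun z => K - χ / s * ((U z - up) * (um - U z))) atTop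
        (nhds (K - χ / s * ((up - up) * (um - up)))) :=
      tendsto_const_nhds.sub (((tUt.sub_const up).mul (tendsto_const_nhds.sub tUt)).const_mul _)
    have := le_of_tendsto' (b := 0) ht (fun z => by
      rw [← hK z]; nlinarith [hU z])
    simpa using this
  have hK2 : K = 0 := by
    by_contra hne
    have hneg : K < 0 := lt_of_le_of_ne hK1 hne
    have hG : ∀ z, HasDerivAt (fun z => D * U z - K * z) (D * deriv U z - K * 1) z := fun z =>
      ((dU z).hasDerivAt.const_mul D).sub ((hasDerivAt_id z).const_mul K)
    have hGa : Antitone (fun z => D * U z - K * z) :=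
      antitone_of_deriv_nonpos (fun z => (hG z).differentiableAt) (fun z => by
        rw [(hG z).deriv]; linarith [hK z, hq z])
    have hz : 0 ≤ D * (U 0 - up) / (-K) := by
      have a := sub_pos.2 (hlo 0)
      have : 0 < -K := by linarith
      positivity
    have hh := hGa hz
    simp only at hh
    have e : K * (D * (U 0 - up) / (-K)) = - (D * (U 0 - up)) := by field_simp
    rw [e] at hh
    nlinarith [hlo (D * (U 0 - up) / (-K))]
  subst hK2
  set L := χ * (um - up) / (D * s) with hL
  have hdpos : 0 < um - up := sub_pos.2 huu
  have hLpos : 0 < L := by positivity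
  set W : ℝ → ℝ := fun z => Real.log (um - U z) - Real.log (U z - up) - L * z with hW
  have hWd : ∀ z, HasDerivAt W 0 z := fun z => by
    have a := sub_pos.2 (hlo z)
    have b := sub_pos.2 (hhi z)
    have := ((((dU z).hasDerivAt.const_sub um).log b.ne').sub
      (((dU z).hasDerivAt.sub_const up).log a.ne')).sub ((hasDerivAt_id z).const_mul L)
    refine HasDerivAt.congr_deriv this ?_
    have e : deriv U z = (0 - χ / s * ((U z - up) * (um - U z))) / D := by
      rw [← hK z]; field_simp
    rw [e, hL]
    have a' := a.ne'
    have b' := b.ne'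
    field_simp
    ring
  refine ⟨W 0 / L, fun z => ⟨?_, hVeq z⟩⟩
  have a := sub_pos.2 (hlo z)
  have b := sub_pos.2 (hhi z)
  have hc : W z = W 0 :=
    is_const_of_deriv_eq_zero (fun x => (hWd x).differentiableAt) (fun x => (hWd x).deriv) z 0
  have e : L * (z + W 0 / L) = Real.log (um - U z) - Real.log (U z - up) := by
    rw [← hc]; simp only [hW]; field_simp; ring
  rw [e, Real.exp_sub, Real.exp_log a, Real.exp_log b]
  have : 1 + (um - U z) / (U z - up) = (um - up) / (U z - up) := by
    field_simp; ring
  rw [this]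
  field_simp
  ring

theorem aux_exists (D χ up um vp vm s : ℝ)
    (hD : 0 < D) (hχ : 0 < χ) (huu : up < um) (hspos : 0 < s)
    (hRH2 : -s * (vp - vm) - (up - um) = 0)
    (hS : s * s + χ * vp * s = χ * um) :
    ∃ U V : ℝ → ℝ, IsMonoWave D χ s up um vp vm (χ * (um - up) / (D * s)) U V := by
  set L := χ * (um - up) / (D * s) with hL
  have hdpos : 0 < um - up := sub_pos.2 huu
  have hLpos : 0 < L := by positivity
  have hpos : ∀ z, 0 < 1 + Real.exp (L * z) := fun z => by positivity
  obtain ⟨U, hUdef⟩ : ∃ U : ℝ → ℝ, U = fun z => up + (um - up) / (1 + Real.exp (L * z)) :=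
    ⟨_, rfl⟩
  have cU : ContDiff ℝ (⊤ : ℕ∞) U := by
    rw [hUdef]
    exact contDiff_const.add (contDiff_const.div
      (contDiff_const.add (contDiff_const.mul contDiff_id).exp) (fun z => (hpos z).ne'))
  have hlo : ∀ z, 0 < U z - up := fun z => by
    have := hpos z
    rw [hUdef]; simp only [add_sub_cancel_left]; positivity
  have ehi : ∀ z, um - U z = (um - up) * Real.exp (L * z) / (1 + Real.exp (L * z)) := fun z => by
    have := (hpos z).ne'
    rw [hUdef]; field_simp; ring
  have hhi : ∀ z, 0 < um - U z := fun z => by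
    have := hpos z
    rw [ehi]; positivity
  have hd : ∀ z, HasDerivAt U (-(χ / (D * s)) * ((U z - up) * (um - U z))) z := fun z => by
    have hp := (hpos z).ne'
    have he : HasDerivAt (fun z => 1 + Real.exp (L * z)) (Real.exp (L * z) * (L * 1)) z :=
      (((hasDerivAt_id z).const_mul L).exp).const_add 1
    have := (((hasDerivAt_const z (um - up)).div he hp)).const_add up
    rw [ehi]
    rw [hUdef]
    refine HasDerivAt.congr_deriv this ?_
    rw [hL] at *
    field_simp
    ring
  have hdU : deriv U = fun z => -(χ / (D * s)) * ((U z - up) * (um - U z)) :=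
    funext fun z => (hd z).deriv
  have hneg : ∀ z, deriv U z < 0 := fun z => by
    have a := hlo z
    have b := hhi z
    have : 0 < χ / (D * s) * ((U z - up) * (um - U z)) := by positivity
    rw [hdU]; simp only; linarith
  have hbd : ∀ z, |deriv U z| ≤ L * (um - up) := fun z => by
    rw [abs_of_neg (hneg z), hdU, hL]
    have a := hlo z
    have b := hhi z
    have : (U z - up) * (um - U z) ≤ (um - up) * (um - up) := by nlinarith
    have k : 0 < χ / (D * s) := by positivity
    calc _ = χ / (D * s) * ((U z - up) * (um - U z)) := by ring
      _ ≤ χ / (D * s) * ((um - up) * (um - up)) := by gcongr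
      _ = _ := by ring
  have hVd : ∀ z, HasDerivAt (fun z => vp + (up - U z) / s) (-deriv U z / s) z := fun z =>
    (((hd z).differentiableAt.hasDerivAt.const_sub up).div_const s).const_add vp
  have tb : Tendsto U atBot (nhds um) := by
    have h1 : Tendsto (fun z => Real.exp (L * z)) atBot (nhds 0) :=
      Real.tendsto_exp_atBot.comp (tendsto_id.const_mul_atBot hLpos)
    have := ((tendsto_const_nhds (x := um - up)).div (h1.const_add 1) (by norm_num)).const_add up
    rw [hUdef]
    simpa using this
  have tt : Tendsto U atTop (nhds up) := by
    have h1 : Tendsto (fun z => 1 + Real.exp (L * z)) atTop atTop :=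
      tendsto_atTop_add_const_left _ _
        (Real.tendsto_exp_atTop.comp (tendsto_id.const_mul_atTop hLpos))
    have := ((tendsto_const_nhds (x := um - up)).div_atTop h1).const_add up
    rw [hUdef]
    simpa using this
  refine ⟨U, fun z => vp + (up - U z) / s, cU,
    contDiff_const.add ((contDiff_const.sub cU).div_const s), fun z => ?_, fun z => ?_, tb, tt,
    ?_, ?_, hneg, fun z => ?_, hbd, fun z => ?_⟩
  · have hp := ((hd z).mul (hVd z)).deriv
    have hdd : deriv (deriv U) z = -(χ / (D * s)) *
        (deriv U z * (um - U z) + (U z - up) * (- deriv U z)) := by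
      have hz := (hd z).differentiableAt.hasDerivAt
      have := (((hz.sub_const up).mul (hz.const_sub um)).const_mul (-(χ / (D * s)))).deriv
      rw [← this]
      conv_lhs => rw [hdU]
      rfl
    rw [hdd]
    have hp' : deriv (fun y => U y * (vp + (up - U y) / s)) z =
      deriv U z * (vp + (up - U z) / s) + U z * (-deriv U z / s) := by
      rw [(hd z).deriv]; rw [(hd z).deriv] at hp; exact hp
    rw [hp']
    have : um = (s * s + χ * vp * s) / χ := by field_simp; linarith
    rw [this]
    field_simp
    ring
  · rw [(hVd z).deriv]; field_simp; ring
  · have e : vm = vp + (up - um) / s := by field_simp; linarith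
    rw [e]
    exact ((tendsto_const_nhds.sub tb).div_const s).const_add vp
  · have := (((tendsto_const_nhds (x := up)).sub tt).div_const s).const_add vp
    simpa using this
  · rw [(hVd z).deriv]
    have := hneg z
    exact div_pos (by linarith) hspos
  · rw [(hVd z).deriv, abs_div, abs_neg, abs_of_pos hspos]
    gcongr
    exact hbd z

/-- Existence and uniqueness (up to translation) of the monotone traveling wave
(Proposition 2.1): under the Rankine–Hugoniot conditions, with
`s = (-χ v₊ + √((χ v₊)² + 4 χ u₋))/2 > 0` and `λ = χ(u₋ - u₊)/(D s)`, there is a monotone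
wave profile `(U, V)` with the stated derivative bounds, and any two such profiles are
translates of each other. -/
theorem stmt3 (D χ up um vp vm s : ℝ)
    (hD : 0 < D) (hχ : 0 < χ) (hup : 0 < up) (huu : up < um)
    (hRH1 : -s * (up - um) - χ * (up * vp - um * vm) = 0)
    (hRH2 : -s * (vp - vm) - (up - um) = 0)
    (hs : s = (-χ * vp + Real.sqrt ((χ * vp) ^ 2 + 4 * χ * um)) / 2)
    (hspos : 0 < s) :
    (∃ U V : ℝ → ℝ, IsMonoWave D χ s up um vp vm (χ * (um - up) / (D * s)) U V) ∧
      ∀ U₁ V₁ U₂ V₂ : ℝ → ℝ,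
        IsMonoWave D χ s up um vp vm (χ * (um - up) / (D * s)) U₁ V₁ →
        IsMonoWave D χ s up um vp vm (χ * (um - up) / (D * s)) U₂ V₂ →
        ∃ c : ℝ, (∀ z, U₂ z = U₁ (z + c)) ∧ ∀ z, V₂ z = V₁ (z + c) := by
  have hS : s * s + χ * vp * s = χ * um := by
    have e : s * vm = s * vp + (up - um) := by linarith
    have h := congrArg (fun x => s * x) hRH1
    simp only [mul_zero] at h
    have h2 : (um - up) * (s * s + χ * vp * s - χ * um) = 0 := by
      linear_combination h - χ * um * e
    rcases mul_eq_zero.1 h2 with h3 | h3 <;> linarith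
  refine ⟨aux_exists D χ up um vp vm s hD hχ huu hspos hRH2 hS, ?_⟩
  intro U₁ V₁ U₂ V₂ h₁ h₂
  obtain ⟨c₁, H₁⟩ := aux_unique D χ up um vp vm s _ hD hχ huu hspos hS U₁ V₁ h₁
  obtain ⟨c₂, H₂⟩ := aux_unique D χ up um vp vm s _ hD hχ huu hspos hS U₂ V₂ h₂
  have key : ∀ z, U₂ z = U₁ (z + (c₂ - c₁)) := fun z => by
    rw [(H₂ z).1, (H₁ _).1]
    have : z + (c₂ - c₁) + c₁ = z + c₂ := by ring
    rw [this]
  exact ⟨c₂ - c₁, key, fun z => by rw [(H₂ z).2, (H₁ _).2, key z]⟩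
end

section
/- Let D, χ, s > 0, u₊ > 0 and v₊ ∈ ℝ with s + χ v₊ > 0. Let U : ℝ → ℝ be twice differentiable with U(x) > 0 for all x, and V : ℝ → ℝ differentiable, such that D U′(x) = u₊(s + χ v₊) − s U(x) − χ U(x) V(x) for all x ∈ ℝ (the first integral of the traveling-wave equations). Then for every x ∈ ℝ, (D/U)″(x) − ((s + χV)/U)′(x) = (2u₊ / U(x)³)(s + χ v₊) U′(x); in particular, this quantity is strictly negative at every point where U′(x) < 0. -/
/-- Key sign identity for the traveling wave profile: if `D U' = u₊(s + χ v₊) - s U - χ U V`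
with `U > 0`, then `(D/U)'' - ((s + χV)/U)' = (2 u₊ / U³)(s + χ v₊) U'`, which is negative
wherever `U' < 0`.  Here `up` stands for `u₊` and `vp` for `v₊`. -/
theorem stmt4 (D χ s up vp : ℝ) (U V : ℝ → ℝ)
    (hD : 0 < D) (hχ : 0 < χ) (hs : 0 < s) (hu : 0 < up) (hsv : 0 < s + χ * vp)
    (hU1 : Differentiable ℝ U) (hU2 : Differentiable ℝ (deriv U))
    (hV : Differentiable ℝ V) (hUpos : ∀ x, 0 < U x)
    (hfirst : ∀ x, D * deriv U x = up * (s + χ * vp) - s * U x - χ * U x * V x) :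
    ∀ x : ℝ,
      deriv (deriv (fun y => D / U y)) x - deriv (fun y => (s + χ * V y) / U y) x
          = 2 * up / (U x) ^ 3 * (s + χ * vp) * deriv U x ∧
        (deriv U x < 0 →
          deriv (deriv (fun y => D / U y)) x
            - deriv (fun y => (s + χ * V y) / U y) x < 0) := by
  intro x
  have hne : ∀ y, U y ≠ 0 := fun y => (hUpos y).ne'
  have h1 : deriv (fun y => D / U y)
      = fun y => (s + χ * V y) / U y - up * (s + χ * vp) / (U y) ^ 2 := by
    funext y
    have h := ((hasDerivAt_const y D).div (hU1 y).hasDerivAt (hne y)).deriv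
    have h' : deriv (fun y => D / U y) y = (0 * U y - D * deriv U y) / (U y) ^ 2 := h
    rw [h', hfirst y]
    have := hne y
    field_simp
    ring
  have hA : DifferentiableAt ℝ (fun y => (s + χ * V y) / U y) x :=
    (((hV x).const_mul χ).const_add s).div (hU1 x) (hne x)
  have hB : HasDerivAt (fun y => up * (s + χ * vp) / (U y) ^ 2)
      (-(2 * up / (U x) ^ 3 * (s + χ * vp) * deriv U x)) x := by
    have h := (hasDerivAt_const x (up * (s + χ * vp))).div ((hU1 x).hasDerivAt.pow 2)
      (pow_ne_zero 2 (hne x))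
    refine HasDerivAt.congr_deriv h ?_
    have := hne x
    simp only [Pi.pow_apply]
    field_simp
    push_cast
    ring
  have key : deriv (deriv (fun y => D / U y)) x - deriv (fun y => (s + χ * V y) / U y) x
      = 2 * up / (U x) ^ 3 * (s + χ * vp) * deriv U x := by
    have h2 := (hA.hasDerivAt.sub hB).deriv
    have h3 : deriv (fun y => (s + χ * V y) / U y - up * (s + χ * vp) / (U y) ^ 2) x = _ := h2
    rw [h1, h3]
    ring
  refine ⟨key, fun hneg => ?_⟩
  rw [key]
  have := hUpos x
  exact mul_neg_of_pos_of_neg (by positivity) hneg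
end

section
/- Let w : ℝ → ℝ be continuously differentiable with w(x) → 0 as |x| → ∞ and 1 + w(x) > 0 for all x ∈ ℝ, and suppose ∫_ℝ w(x)²(1 + w(x)) dx and ∫_ℝ w′(x)²/(1 + w(x)) dx are finite. Then ‖w‖_{L^∞(ℝ)}⁴ ≤ 16 (∫_ℝ w(x)²(1 + w(x)) dx) (∫_ℝ w′(x)²/(1 + w(x)) dx). -/
open MeasureTheory Filter

/-- Weighted Gagliardo–Nirenberg type inequality: for `w` continuously differentiable,
vanishing at infinity, with `1 + w > 0`,
`‖w‖_∞⁴ ≤ 16 (∫ w²(1+w)) (∫ w'²/(1+w))`. -/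
theorem stmt19 (w : ℝ → ℝ) (hw : ContDiff ℝ 1 w)
    (hdecay : Tendsto w (cocompact ℝ) (nhds 0))
    (hpos : ∀ x, 0 < 1 + w x)
    (hint1 : Integrable (fun x => (w x) ^ 2 * (1 + w x)))
    (hint2 : Integrable (fun x => (deriv w x) ^ 2 / (1 + w x))) :
    ∀ x : ℝ, |w x| ^ 4 ≤
      16 * (∫ x : ℝ, (w x) ^ 2 * (1 + w x)) * ∫ x : ℝ, (deriv w x) ^ 2 / (1 + w x) := by
  intro x
  have hd : ∀ y, HasDerivAt w (deriv w y) y := fun y =>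
    (hw.differentiable (by norm_num) y).hasDerivAt
  have hc : Continuous w := hw.continuous
  have hc' : Continuous (deriv w) := hw.continuous_deriv (by norm_num)
  set A := ∫ x : ℝ, (w x) ^ 2 * (1 + w x) with hA
  set B := ∫ x : ℝ, (deriv w x) ^ 2 / (1 + w x) with hB
  have hA0 : 0 ≤ A := integral_nonneg fun y => mul_nonneg (sq_nonneg _) (hpos y).le
  have hB0 : 0 ≤ B := integral_nonneg fun y => div_nonneg (sq_nonneg _) (hpos y).le
  have key : ∀ t : ℝ, 0 < t → ∀ y, |2 * w y * deriv w y| ≤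
      t * ((w y) ^ 2 * (1 + w y)) + t⁻¹ * ((deriv w y) ^ 2 / (1 + w y)) := by
    intro t ht y
    have hp := hpos y
    have h1 : ∀ e : ℝ, e ^ 2 = 1 → e * (2 * w y * deriv w y) ≤
        t * ((w y) ^ 2 * (1 + w y)) + t⁻¹ * ((deriv w y) ^ 2 / (1 + w y)) := by
      intro e he
      have h2 : 0 ≤ (t * (w y * (1 + w y)) - e * deriv w y) ^ 2 / (t * (1 + w y)) := by
        positivity
      have h3 : (t * (w y * (1 + w y)) - e * deriv w y) ^ 2 / (t * (1 + w y)) =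
        t * ((w y) ^ 2 * (1 + w y)) + e ^ 2 * (t⁻¹ * ((deriv w y) ^ 2 / (1 + w y)))
          - e * (2 * w y * deriv w y) := by
        field_simp
        ring
      rw [h3, he] at h2
      linarith
    rw [abs_le]
    have ha := h1 1 (by norm_num)
    have hb := h1 (-1) (by norm_num)
    constructor <;> linarith
  have hint : Integrable (fun y => 2 * w y * deriv w y) := by
    refine ((hint1.const_mul 1).add (hint2.const_mul 1⁻¹)).mono'
      (by fun_prop) (Eventually.of_forall fun y => ?_)
    simpa using key 1 one_pos y
  have hlim : Tendsto (fun y => w y ^ 2) atBot (nhds 0) := by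
    have := (hdecay.mono_left (atBot_le_cocompact)).pow 2
    simpa using this
  have ftc : ∫ y in Set.Iic x, 2 * w y * deriv w y = w x ^ 2 - 0 := by
    refine integral_Iic_of_hasDerivAt_of_tendsto' (f := fun y => w y ^ 2) (fun y _ => ?_)
      hint.integrableOn hlim
    have h8 := (hd y).fun_pow 2
    norm_num at h8
    exact h8
  have bound : ∀ t : ℝ, 0 < t → w x ^ 2 ≤ t * A + t⁻¹ * B := by
    intro t ht
    calc w x ^ 2 = ∫ y in Set.Iic x, 2 * w y * deriv w y := by rw [ftc, sub_zero]
      _ ≤ ∫ y in Set.Iic x, |2 * w y * deriv w y| :=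
        integral_mono hint.integrableOn hint.abs.integrableOn fun y => le_abs_self _
      _ ≤ ∫ y, |2 * w y * deriv w y| :=
        setIntegral_le_integral hint.abs (Eventually.of_forall fun y => abs_nonneg _)
      _ ≤ ∫ y, (t * ((w y) ^ 2 * (1 + w y)) + t⁻¹ * ((deriv w y) ^ 2 / (1 + w y))) :=
        integral_mono hint.abs ((hint1.const_mul t).add (hint2.const_mul t⁻¹)) (key t ht)
      _ = t * A + t⁻¹ * B := by
        rw [integral_add (hint1.const_mul t) (hint2.const_mul t⁻¹), integral_const_mul,
          integral_const_mul]
  have quad : ∀ t : ℝ, 0 ≤ A * (t * t) + (-(w x ^ 2)) * t + B := by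
    intro t
    rcases lt_or_ge 0 t with ht | ht
    · have h := mul_le_mul_of_nonneg_left (bound t ht) ht.le
      have h4 : t * (t * A + t⁻¹ * B) = A * (t * t) + B := by field_simp
      rw [h4] at h
      linarith
    · have h5 := mul_nonneg hA0 (mul_self_nonneg t)
      have h6 := mul_nonneg (sq_nonneg (w x)) (neg_nonneg.mpr ht)
      linarith
  have hdisc := discrim_le_zero quad
  unfold discrim at hdisc
  have h7 : |w x| ^ 4 = (-(w x ^ 2)) ^ 2 := by
    rw [show |w x| ^ 4 = (|w x| ^ 2) ^ 2 by ring, sq_abs]; ring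
  rw [h7]
  have := mul_nonneg hA0 hB0
  linarith
end
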